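/- arXiv:1706.04963 — 3 statements merged into one kernel-verified Lean document; each statement's English description precedes it below -/
import Mathlib

section
/- Let F be a semisimple ℚ-algebra and let G be a finite group acting on F by ring automorphisms. Then the twisted group ring F⟨G⟩ is a semisimple ring. -/
open Finset

/-- The twisted (skew) group ring `F⟨G⟩` of a finite group `G` acting on a ring `F`
by ring automorphisms, realized on the free `F`-module `G → F` of functions,
with multiplication determined by the commutation relation `σ · r = (σ • r) · σ`. -/
def TwistedGroupRing (F G : Type*) [Ring F] [Group G] [Fintype G] [DecidableEq G]
    [MulSemiringAction G F] : Type _ := G → F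

namespace TwistedGroupRing

variable {F G : Type*} [Ring F] [Group G] [Fintype G] [DecidableEq G] [MulSemiringAction G F]

/-- Interpret an element of the twisted group ring as a function `G → F`
(its coordinates with respect to the standard basis `G`). -/
def coeff (f : TwistedGroupRing F G) : G → F := f

/-- Build an element of the twisted group ring from its coordinate function. -/
def ofCoeff (f : G → F) : TwistedGroupRing F G := f

instance : AddCommGroup (TwistedGroupRing F G) := Pi.addCommGroup

@[simp] theorem coeff_add (f g : TwistedGroupRing F G) (z : G) :
    coeff (f + g) z = coeff f z + coeff g z := rfl

@[simp] theorem coeff_zero (z : G) : coeff (0 : TwistedGroupRing F G) z = 0 := rfl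

@[simp] theorem coeff_neg (f : TwistedGroupRing F G) (z : G) :
    coeff (-f) z = -coeff f z := rfl

theorem coeff_injective : Function.Injective (coeff (F := F) (G := G)) := fun _ _ h => h

instance : Mul (TwistedGroupRing F G) :=
  ⟨fun f g => ofCoeff fun z => ∑ x : G, coeff f x * x • coeff g (x⁻¹ * z)⟩

@[simp] theorem coeff_mul (f g : TwistedGroupRing F G) (z : G) :
    coeff (f * g) z = ∑ x : G, coeff f x * x • coeff g (x⁻¹ * z) := rfl

instance : One (TwistedGroupRing F G) := ⟨ofCoeff (Pi.single (1 : G) (1 : F))⟩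

@[simp] theorem coeff_one :
    coeff (1 : TwistedGroupRing F G) = Pi.single (1 : G) (1 : F) := rfl

instance : Monoid (TwistedGroupRing F G) where
  mul_assoc f g h := by
    apply coeff_injective; funext z
    simp only [coeff_mul, Finset.sum_mul, smul_sum, Finset.mul_sum, smul_mul', mul_smul]
    rw [Finset.sum_comm]
    refine Finset.sum_congr rfl fun u _ => ?_
    refine (Fintype.sum_equiv (Equiv.mulLeft u) _ _ fun v => ?_).symm
    simp [mul_assoc, mul_smul, mul_inv_rev]
  one_mul f := by
    apply coeff_injective; funext z
    rw [coeff_mul, Finset.sum_eq_single_of_mem (1 : G) (mem_univ _)]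
    · simp
    · intro x _ hx
      rw [coeff_one, Pi.single_eq_of_ne hx, zero_mul]
  mul_one f := by
    apply coeff_injective; funext z
    rw [coeff_mul, Finset.sum_eq_single_of_mem z (mem_univ _)]
    · simp
    · intro x _ hx
      rw [coeff_one, Pi.single_eq_of_ne (by simpa [inv_mul_eq_one] using hx),
        smul_zero, mul_zero]

instance : Ring (TwistedGroupRing F G) :=
  { (inferInstance : AddCommGroup (TwistedGroupRing F G)),
    (inferInstance : Monoid (TwistedGroupRing F G)) with
    left_distrib := fun f g h => by
      apply coeff_injective; funext z
      simp [smul_add, mul_add, Finset.sum_add_distrib]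
    right_distrib := fun f g h => by
      apply coeff_injective; funext z
      simp [add_mul, Finset.sum_add_distrib]
    zero_mul := fun f => by
      apply coeff_injective; funext z
      simp
    mul_zero := fun f => by
      apply coeff_injective; funext z
      simp }

/-- The element `r·σ` of the twisted group ring. -/
def single (σ : G) (r : F) : TwistedGroupRing F G := ofCoeff (Pi.single σ r)

@[simp] theorem coeff_single (σ : G) (r : F) :
    coeff (single σ r) = Pi.single σ r := rfl

/-- The canonical ring homomorphism `F → F⟨G⟩`, `r ↦ r·1`. -/
def C : F →+* TwistedGroupRing F G where
  toFun r := single 1 r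
  map_one' := rfl
  map_mul' r s := by
    apply coeff_injective; funext z
    rw [coeff_mul, Finset.sum_eq_single_of_mem (1 : G) (mem_univ _)]
    · by_cases h : z = 1 <;> simp [h, Pi.single_eq_of_ne]
    · intro x _ hx
      rw [coeff_single, Pi.single_eq_of_ne hx, zero_mul]
  map_zero' := by
    apply coeff_injective; funext z; simp
  map_add' r s := by
    apply coeff_injective; funext z
    by_cases h : z = 1 <;> simp [h, Pi.single_eq_of_ne]

end TwistedGroupRing


namespace TwistedGroupRing

variable {F G : Type*} [Ring F] [Group G] [Fintype G] [DecidableEq G] [MulSemiringAction G F]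

theorem single_mul_single' (a b : G) (r s : F) :
    single a r * single b s = single (a * b) (r * a • s) := by
  apply coeff_injective; funext z
  rw [coeff_mul, Finset.sum_eq_single_of_mem a (mem_univ _)]
  · by_cases h : z = a * b
    · subst h; simp
    · have h' : a⁻¹ * z ≠ b := fun h' => h (by rw [← h']; simp)
      simp [Pi.single_eq_of_ne h, Pi.single_eq_of_ne h']
  · intro x _ hx
    rw [coeff_single, Pi.single_eq_of_ne hx, zero_mul]

theorem C_eq (r : F) : (C r : TwistedGroupRing F G) = single 1 r := rfl

theorem one_eq : (1 : TwistedGroupRing F G) = single 1 1 := rfl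

theorem sum_single' (a : TwistedGroupRing F G) :
    a = ∑ g : G, C (coeff a g) * single g 1 := by
  have h := Finset.univ_sum_single (coeff a)
  simp only [C_eq, single_mul_single', one_mul, smul_one, mul_one]
  exact h.symm

/-- The averaging operator of Maschke's theorem. -/
def avg (p : TwistedGroupRing F G →+ TwistedGroupRing F G) :
    TwistedGroupRing F G →+ TwistedGroupRing F G where
  toFun x := ∑ g : G, single g 1 * p (single g⁻¹ 1 * x)
  map_zero' := by simp
  map_add' x y := by simp [mul_add, Finset.sum_add_distrib]

theorem avg_apply (p : TwistedGroupRing F G →+ TwistedGroupRing F G) (x) :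
    avg p x = ∑ g : G, single g 1 * p (single g⁻¹ 1 * x) := rfl

theorem avg_mul (p : TwistedGroupRing F G →+ TwistedGroupRing F G)
    (hp : ∀ r x, p (C r * x) = C r * p x) (a x : TwistedGroupRing F G) :
    avg p (a * x) = a * avg p x := by
  have h1 : ∀ r x, avg p (C r * x) = C r * avg p x := by
    intro r x
    rw [avg_apply, avg_apply, Finset.mul_sum]
    refine Finset.sum_congr rfl fun g _ => ?_
    have e : (single g⁻¹ 1 : TwistedGroupRing F G) * (C r * x)
        = C (g⁻¹ • r) * (single g⁻¹ 1 * x) := by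
      rw [← mul_assoc, ← mul_assoc, C_eq, C_eq, single_mul_single', single_mul_single']
      simp
    rw [e, hp, ← mul_assoc, ← mul_assoc, C_eq, C_eq, single_mul_single', single_mul_single']
    simp
  have h2 : ∀ h x, avg p (single h 1 * x) = single h 1 * avg p x := by
    intro h x
    rw [avg_apply, avg_apply, Finset.mul_sum]
    refine (Fintype.sum_equiv (Equiv.mulLeft h) _ _ fun g => ?_).symm
    rw [← mul_assoc, ← mul_assoc, single_mul_single', single_mul_single']
    simp
  conv_lhs => rw [sum_single' a, Finset.sum_mul, map_sum]
  conv_rhs => rw [sum_single' a, Finset.sum_mul]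
  refine Finset.sum_congr rfl fun g _ => ?_
  rw [mul_assoc, h1, h2, mul_assoc]

theorem exists_proj [IsSemisimpleRing F]
    (I : Submodule (TwistedGroupRing F G) (TwistedGroupRing F G)) :
    ∃ p : TwistedGroupRing F G →+ TwistedGroupRing F G,
      (∀ r x, p (C r * x) = C r * p x) ∧ (∀ x, p x ∈ I) ∧ ∀ x ∈ I, p x = x := by
  let _ : Module F (TwistedGroupRing F G) := Module.compHom _ (C : F →+* TwistedGroupRing F G)
  have hs : ∀ (r : F) (x : TwistedGroupRing F G), r • x = C r * x := fun _ _ => rfl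
  let I' : Submodule F (TwistedGroupRing F G) :=
    { carrier := I
      add_mem' := I.add_mem
      zero_mem' := I.zero_mem
      smul_mem' := fun r x hx => I.smul_mem (C r) hx }
  obtain ⟨J, hJ⟩ := exists_isCompl I'
  refine ⟨(I'.subtype ∘ₗ I'.projectionOnto J hJ).toAddMonoidHom, fun r x => ?_, fun x => ?_,
    fun x hx => ?_⟩
  · exact (I'.subtype ∘ₗ I'.projectionOnto J hJ).map_smul r x
  · exact (I'.projectionOnto J hJ x).2
  · exact congrArg Subtype.val (Submodule.projectionOnto_apply_left hJ (⟨x, hx⟩ : I'))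

end TwistedGroupRing

/-- If `F` is a semisimple `ℚ`-algebra and `G` is a finite group acting on
`F` by ring automorphisms, then the twisted group ring `F⟨G⟩` is a semisimple ring. -/
theorem isSemisimpleRing_twistedGroupRing
    (F G : Type*) [Ring F] [Algebra ℚ F] [IsSemisimpleRing F]
    [Group G] [Fintype G] [DecidableEq G] [MulSemiringAction G F] :
    IsSemisimpleRing (TwistedGroupRing F G) := by
  refine (isSemisimpleModule_iff _ _).mpr ⟨fun I => ?_⟩
  obtain ⟨p, hp, hpI, hpid⟩ := TwistedGroupRing.exists_proj I
  set c : TwistedGroupRing F G :=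
    TwistedGroupRing.C (algebraMap ℚ F ((Fintype.card G : ℚ)⁻¹)) with hc
  have hn : (Fintype.card G : TwistedGroupRing F G)
      = TwistedGroupRing.C (algebraMap ℚ F (Fintype.card G : ℚ)) := by simp
  have h0 : (Fintype.card G : ℚ) ≠ 0 := by simp
  have hcn : c * (Fintype.card G : TwistedGroupRing F G) = 1 := by
    rw [hn, hc, ← map_mul, ← map_mul, inv_mul_cancel₀ h0, map_one, map_one]
  have hnc : (Fintype.card G : TwistedGroupRing F G) * c = 1 := by
    rw [hn, hc, ← map_mul, ← map_mul, mul_inv_cancel₀ h0, map_one, map_one]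
  have hcomm : ∀ a, Commute c a := fun a =>
    Commute.units_inv_left (u := ⟨_, c, hnc, hcn⟩) (Nat.cast_commute _ a)
  let P : TwistedGroupRing F G →ₗ[TwistedGroupRing F G] TwistedGroupRing F G :=
    { toFun := fun x => c * TwistedGroupRing.avg p x
      map_add' := fun x y => by rw [map_add, mul_add]
      map_smul' := fun a x => by
        simp only [smul_eq_mul, RingHom.id_apply]
        rw [TwistedGroupRing.avg_mul p hp, ← mul_assoc, ← mul_assoc, (hcomm a).eq] }
  have hPI : ∀ x, P x ∈ I := fun x =>
    I.smul_mem c (I.sum_mem fun g _ => I.smul_mem (TwistedGroupRing.single g 1) (hpI _))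
  have hPid : ∀ x ∈ I, P x = x := by
    intro x hx
    change c * TwistedGroupRing.avg p x = x
    have : TwistedGroupRing.avg p x = (Fintype.card G : TwistedGroupRing F G) * x := by
      rw [TwistedGroupRing.avg_apply, ← nsmul_eq_mul, Fintype.card, ← Finset.sum_const]
      refine Finset.sum_congr rfl fun g _ => ?_
      rw [hpid (TwistedGroupRing.single g⁻¹ 1 * x) (I.smul_mem (TwistedGroupRing.single g⁻¹ 1) hx), ← mul_assoc,
        TwistedGroupRing.single_mul_single']
      simp [← TwistedGroupRing.one_eq]
    rw [this, ← mul_assoc, hcn, one_mul]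
  exact ⟨_, LinearMap.isCompl_of_proj (f := P.codRestrict I hPI) fun x =>
    Subtype.ext (hPid x x.2)⟩
end

section
/- Let F be a ℚ-algebra and let σ be a ring automorphism of F with σ ∘ σ = id, giving an action of the group G = ℤ/2ℤ on F whose nontrivial element acts by σ; let A := F⟨G⟩ be the twisted group ring. Let F₊ denote the left A-module whose underlying F-module is F and on which the group element σ acts by x ↦ σ(x), and let F₋ (the twist ᵟF) denote the left A-module whose underlying F-module is F and on which the group element σ acts by x ↦ −σ(x). Then the map φ : F₊ ⊕ F₋ → A defined by φ(a, b) = a·(σ + 1) + b·(σ − 1) is an isomorphism of left A-modules; in particular A ≅ F₊ ⊕ F₋ as left A-modules. -/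
open Finset

namespace TwistedGroupRing

theorem aux_single_mul {F G : Type*} [Ring F] [Group G] [Fintype G] [DecidableEq G]
    [MulSemiringAction G F] (s : G) (r : F) (f : TwistedGroupRing F G) (z : G) :
    coeff (single s r * f) z = r * s • coeff f (s⁻¹ * z) := by
  rw [coeff_mul, Finset.sum_eq_single_of_mem s (mem_univ _)]
  · simp
  · intro x _ hx
    rw [coeff_single, Pi.single_eq_of_ne hx, zero_mul]

theorem aux_C_mul {F G : Type*} [Ring F] [Group G] [Fintype G] [DecidableEq G]
    [MulSemiringAction G F] (r : F) (f : TwistedGroupRing F G) (z : G) :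
    coeff (C r * f) z = r * coeff f z := by
  refine (aux_single_mul 1 r f z).trans ?_
  rw [inv_one, one_mul, one_smul]

theorem aux_coeff_sub {F G : Type*} [Ring F] [Group G] [Fintype G] [DecidableEq G]
    [MulSemiringAction G F] (f g : TwistedGroupRing F G) (z : G) :
    coeff (f - g) z = coeff f z - coeff g z := rfl

end TwistedGroupRing

open TwistedGroupRing in
/-- Let `F` be a `ℚ`-algebra and `σ` a ring automorphism of `F` with
`σ ∘ σ = id`, giving an action of `G = ℤ/2ℤ` on `F` whose nontrivial element acts by `σ`;
let `A := F⟨G⟩`.  Writing `F₊ ⊕ F₋` for `F × F` with `F` acting diagonally by multiplication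
and the group element `σ` acting by `(a, b) ↦ (σ a, -σ b)`, the map
`φ(a,b) = a·(σ + 1) + b·(σ - 1)` is an isomorphism of left `A`-modules `F₊ ⊕ F₋ → A`;
`A`-linearity is expressed by additivity together with compatibility with the actions of the
generators `r·1` (`r ∈ F`) and `σ` of `A`. -/
theorem twistedGroupRing_quadratic_decomposition
    (F : Type*) [Ring F] [Algebra ℚ F]
    (σ : F ≃+* F) (hσ : ∀ x, σ (σ x) = x)
    [MulSemiringAction (Multiplicative (ZMod 2)) F]
    (hact : ∀ x : F, (Multiplicative.ofAdd (1 : ZMod 2)) • x = σ x) :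
    ∀ φ : F × F → TwistedGroupRing F (Multiplicative (ZMod 2)),
      (φ = fun ab =>
          C ab.1 * (single (Multiplicative.ofAdd (1 : ZMod 2)) (1 : F) + 1)
            + C ab.2 * (single (Multiplicative.ofAdd (1 : ZMod 2)) (1 : F) - 1)) →
      Function.Bijective φ ∧
      (∀ ab ab' : F × F, φ (ab + ab') = φ ab + φ ab') ∧
      (∀ (r : F) (ab : F × F), φ (r * ab.1, r * ab.2) = C r * φ ab) ∧
      (∀ ab : F × F, φ (σ ab.1, -σ ab.2) =
        single (Multiplicative.ofAdd (1 : ZMod 2)) (1 : F) * φ ab) := by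
  intro φ hφ
  set s : Multiplicative (ZMod 2) := Multiplicative.ofAdd (1 : ZMod 2) with hs
  have hs1 : s ≠ 1 := by decide
  have hG : ∀ z : Multiplicative (ZMod 2), z = 1 ∨ z = s := by decide
  have hinv : s⁻¹ = s := by decide
  have hss : s * s = 1 := by decide
  have h1 : ∀ ab, coeff (φ ab) 1 = ab.1 - ab.2 := by
    intro ab
    subst hφ
    simp [-coeff_mul, aux_C_mul, aux_coeff_sub, Pi.single_eq_of_ne hs1.symm, sub_eq_add_neg]
  have h2 : ∀ ab, coeff (φ ab) s = ab.1 + ab.2 := by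
    intro ab
    subst hφ
    simp [-coeff_mul, aux_C_mul, aux_coeff_sub, Pi.single_eq_of_ne hs1]
  have ext2 : ∀ f g : TwistedGroupRing F (Multiplicative (ZMod 2)),
      coeff f 1 = coeff g 1 → coeff f s = coeff g s → f = g := by
    intro f g e1 e2
    apply coeff_injective
    funext z
    rcases hG z with rfl | h
    · exact e1
    · rw [h]; exact e2
  have half : ∀ x : F, (1/2 : ℚ) • x + (1/2 : ℚ) • x = x := by
    intro x
    rw [← add_smul]; norm_num
  clear_value s
  refine ⟨⟨?_, ?_⟩, ?_, ?_, ?_⟩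
  · intro x y hxy
    have e1 : x.1 - x.2 = y.1 - y.2 := by rw [← h1, ← h1, hxy]
    have e2 : x.1 + x.2 = y.1 + y.2 := by rw [← h2, ← h2, hxy]
    have k : x.1 = y.1 := by
      have t : x.1 + x.1 = y.1 + y.1 := by
        calc x.1 + x.1 = (x.1 - x.2) + (x.1 + x.2) := by abel
          _ = (y.1 - y.2) + (y.1 + y.2) := by rw [e1, e2]
          _ = _ := by abel
      rw [← half x.1, ← half y.1, ← smul_add, ← smul_add, t]
    refine Prod.ext k ?_
    rw [k] at e2
    exact add_left_cancel e2
  · intro f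
    refine ⟨((1/2 : ℚ) • (coeff f s + coeff f 1), (1/2 : ℚ) • (coeff f s - coeff f 1)), ?_⟩
    apply ext2
    · rw [h1]
      simp only [smul_add, smul_sub]
      conv_rhs => rw [← half (coeff f 1)]
      abel
    · rw [h2]
      simp only [smul_add, smul_sub]
      conv_rhs => rw [← half (coeff f s)]
      abel
  · intro x y
    apply ext2
    · simp only [coeff_add, h1, Prod.fst_add, Prod.snd_add]; abel
    · simp only [coeff_add, h2, Prod.fst_add, Prod.snd_add]; abel
  · intro r x
    apply ext2
    · rw [aux_C_mul, h1, h1, mul_sub]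
    · rw [aux_C_mul, h2, h2, mul_add]
  · intro x
    apply ext2
    · rw [aux_single_mul, hinv, mul_one, h1, h2, hact, map_add, one_mul, sub_neg_eq_add]
    · rw [aux_single_mul, hinv, hss, h1, h2, hact, map_sub, one_mul, sub_eq_add_neg]
end

section
/- Let k'/k be a finite Galois extension of fields with Galois group G = Gal(k'/k). Then there is an isomorphism of k'-algebras k' ⊗_k k' ≅ ∏_{σ ∈ G} k', given on pure tensors by x ⊗ y ↦ (x · σ(y))_{σ ∈ G}, where the k'-algebra structure on the tensor product comes from the left tensor factor. -/
open TensorProduct in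
/-- If `k'/k` is a finite Galois extension of fields with Galois group
`G = Gal(k'/k)`, then there is an isomorphism of `k'`-algebras
`k' ⊗_k k' ≅ ∏_{σ ∈ G} k'`, given on pure tensors by `x ⊗ y ↦ (x · σ(y))_σ`,
where the `k'`-algebra structure on the tensor product comes from the left factor
and the product ring is a `k'`-algebra via the diagonal. -/
theorem galois_tensorProduct_self_equiv_pi
    (k k' : Type*) [Field k] [Field k'] [Algebra k k'] [FiniteDimensional k k']
    [IsGalois k k'] :
    ∃ e : (k' ⊗[k] k') ≃ₐ[k'] ((k' ≃ₐ[k] k') → k'),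
      ∀ x y : k', e (x ⊗ₜ[k] y) = fun σ : k' ≃ₐ[k] k' => x * σ y := by
  classical
  let φ : (k' ⊗[k] k') →ₐ[k'] ((k' ≃ₐ[k] k') → k') :=
    AlgHom.pi fun σ =>
      Algebra.TensorProduct.lift (AlgHom.id k' k') (σ : k' →ₐ[k] k') fun _ _ => Commute.all _ _
  have hφ : ∀ x y : k', φ (x ⊗ₜ[k] y) = fun σ : k' ≃ₐ[k] k' => x * σ y := by
    intro x y
    ext σ
    simp [φ]
  have hsurj : Function.Surjective φ.toLinearMap := by
    rw [← LinearMap.range_eq_top]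
    by_contra hne
    obtain ⟨f, hf0, hf⟩ := Submodule.exists_le_ker_of_lt_top _ (lt_top_iff_ne_top.mpr hne)
    have hli := (linearIndependent_monoidHom k' k').comp
      (fun σ : k' ≃ₐ[k] k' => ((σ : k' ≃* k') : k' →* k'))
      (fun σ τ h => by
        ext y
        exact DFunLike.congr_fun h y)
    rw [Fintype.linearIndependent_iff] at hli
    have hsum : ∀ v : (k' ≃ₐ[k] k') → k', f v = ∑ σ, v σ * f (Pi.single σ 1) := fun v => by
      rw [LinearMap.pi_apply_eq_sum_univ f v]
      refine Finset.sum_congr rfl fun σ _ => ?_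
      rw [smul_eq_mul]
      congr 2
      ext j
      simp [Pi.single_apply, eq_comm]
    have hc := hli (fun σ => f (Pi.single σ 1)) (by
      ext y
      have h1 : f (φ ((1 : k') ⊗ₜ[k] y)) = 0 := hf (LinearMap.mem_range_self φ.toLinearMap ((1 : k') ⊗ₜ[k] y))
      rw [hφ, hsum] at h1
      rw [Finset.sum_apply]
      refine Eq.trans (Finset.sum_congr rfl fun σ _ => ?_) h1
      rw [one_mul, mul_comm (σ y)]
      rfl)
    apply hf0
    ext v
    simp [hc]
  have hrank : Module.finrank k' (k' ⊗[k] k') = Module.finrank k' ((k' ≃ₐ[k] k') → k') := by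
    rw [Module.finrank_baseChange, Module.finrank_fintype_fun_eq_card, ← Nat.card_eq_fintype_card,
      IsGalois.card_aut_eq_finrank]
  have hinj : Function.Injective φ.toLinearMap :=
    (LinearMap.injective_iff_surjective_of_finrank_eq_finrank hrank).mpr hsurj
  exact ⟨AlgEquiv.ofBijective φ ⟨hinj, hsurj⟩, hφ⟩
end
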